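/- Let $\beta\in\{1,2\}$, $r\geq 2$ with $r\geq\beta$, and $M\geq 128$. Let $x\in[0,1]^N$ with $D_1^{\beta}x$ satisfying the $\Lambda_M$-minimum separation condition, let $q\in\mathbb{R}^N$ satisfy $\|D^{-r}(x-q)\|_\infty\leq\delta/2$ and $\|(D^{-r}(x-q))_{N-r+1:N}\|_\infty\leq(\tfrac{1}{2N})^{r}\delta$, and let $\hat{x}$ minimize $\|D_1^{\beta}z\|_1$ subject to these same two constraints on $z$. Then $\left|\sum_{n=1}^{N}(\hat{x}-x)_n\right|\leq \frac{\delta}{N^{r}}$, and consequently, with $K_L(t)=\frac{1}{N}\sum_{k=-L,k\neq0}^{L}e^{2\pi ikt}$ and $\mathbf{K_L}$ its discretization on the grid $t_n=n/N$, $\|P_L(\hat{x}-x)-\mathbf{K_L}\ast(\hat{x}-x)\|_\infty\leq\frac{\delta}{N^{r+1}}$ for every $1\leq L\leq N/2$, where $\ast$ is circular convolution on $\{0,\dots,N-1\}$. -/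

import Mathlib

open scoped BigOperators
open Finset Matrix

/-- The `N × N` finite difference matrix with `1`s on the diagonal and `-1`s on
the subdiagonal. -/
noncomputable def Dmat (N : ℕ) : Matrix (Fin N) (Fin N) ℝ :=
  Matrix.of fun i j => if i = j then 1 else if (j : ℕ) + 1 = (i : ℕ) then -1 else 0

/-- The `N × N` circulant difference matrix: `Dmat` with an extra `-1` in the
upper-right corner. -/
noncomputable def D1mat (N : ℕ) : Matrix (Fin N) (Fin N) ℝ :=
  Matrix.of fun i j => if i = j then 1 else if ((j : ℕ) + 1) % N = (i : ℕ) then -1 else 0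

/-- Entrywise ℓ¹ norm of a vector. -/
noncomputable def l1 {N : ℕ} (v : Fin N → ℝ) : ℝ := ∑ i, |v i|

/-- Wrap-around distance on `{0, …, N-1}`. -/
def wrapDist (N : ℕ) (i j : Fin N) : ℕ :=
  min ((i : ℤ) - (j : ℤ)).natAbs (N - ((i : ℤ) - (j : ℤ)).natAbs)

/-- The `Λ_M` minimum separation condition for a vector `v ∈ ℝ^N`. -/
def minSep (N M : ℕ) (v : Fin N → ℝ) : Prop :=
  ∀ i j : Fin N, v i ≠ 0 → v j ≠ 0 → i ≠ j →
    (2 : ℝ) / M ≤ (wrapDist N i j : ℝ) / N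

/-- The projection `P_L = (1/N) F_L^* F_L` onto DFT frequencies `{-L, …, L}`. -/
noncomputable def Pproj (N L : ℕ) : Matrix (Fin N) (Fin N) ℝ :=
  Matrix.of fun m n => (1 / (N : ℝ)) *
    ∑ k ∈ Finset.Icc (-(L : ℤ)) (L : ℤ),
      Real.cos (2 * Real.pi * (k : ℝ) * (((m : ℕ) : ℝ) - ((n : ℕ) : ℝ)) / N)

/-- Discretization of the (real-valued) kernel
`K_L(t) = (1/N) ∑_{1 ≤ |k| ≤ L} e^{2πikt}` on the grid `t_n = n/N`. -/
noncomputable def KLvec (N L : ℕ) (n : Fin N) : ℝ :=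
  (1 / (N : ℝ)) *
    ∑ k ∈ (Finset.Icc (-(L : ℤ)) (L : ℤ)).erase 0,
      Real.cos (2 * Real.pi * (k : ℝ) * ((n : ℕ) : ℝ) / N)

lemma Dmat_isUnit (N : ℕ) : IsUnit (Dmat N).det := by
  have h : (Dmat N).det = 1 := by
    rw [Matrix.det_of_lowerTriangular]
    · simp [Dmat]
    · intro i j hij
      have h1 : i < j := hij
      have h2 : (i : ℕ) < j := h1
      have h3 : ¬ ((j : ℕ) + 1 = i) := by omega
      simp [Dmat, h1.ne, h3]
  rw [h]; exact isUnit_one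

/-- Shifted extension of a vector by zero. -/
noncomputable def shiftExt {N : ℕ} (w : Fin N → ℝ) (k : ℕ) : ℝ :=
  if h : 1 ≤ k ∧ k - 1 < N then w ⟨k - 1, h.2⟩ else 0

lemma Dmat_mulVec {N : ℕ} (w : Fin N → ℝ) (i : Fin N) :
    (Dmat N).mulVec w i = shiftExt w (i + 1) - shiftExt w i := by
  have e1 : shiftExt w (i + 1) = w i := by simp [shiftExt]
  rw [e1]
  have h0 : (Dmat N).mulVec w i =
      ∑ j, ((if i = j then w j else 0) - (if (j : ℕ) + 1 = i then w j else 0)) := by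
    unfold Matrix.mulVec dotProduct
    refine Finset.sum_congr rfl fun j _ => ?_
    by_cases h : i = j
    · subst h; simp [Dmat]
    · by_cases h' : (j : ℕ) + 1 = i <;> simp [Dmat, h, h']
  rw [h0, Finset.sum_sub_distrib]
  congr 1
  · simp
  · unfold shiftExt
    split_ifs with h
    · rw [Finset.sum_eq_single ⟨(i : ℕ) - 1, h.2⟩]
      · have : (i : ℕ) - 1 + 1 = i := by omega
        simp [this]
      · intro b _ hb
        rw [if_neg]
        intro hh
        apply hb
        apply Fin.ext
        simp only
        omega
      · simp
    · apply Finset.sum_eq_zero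
      intro j _
      rw [if_neg]
      have := i.2
      omega

lemma sum_Dmat_mulVec {N : ℕ} (hN : 0 < N) (w : Fin N → ℝ) :
    ∑ i, (Dmat N).mulVec w i = w ⟨N - 1, by omega⟩ := by
  simp_rw [Dmat_mulVec]
  rw [Fin.sum_univ_eq_sum_range (fun i => shiftExt w (i + 1) - shiftExt w i),
    Finset.sum_range_sub]
  have h : 1 ≤ N ∧ N - 1 < N := by omega
  unfold shiftExt
  rw [dif_pos h]
  simp

lemma Dmat_pow_bound {N r : ℕ} (v : Fin N → ℝ) (B : ℝ) (hB : 0 ≤ B)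
    (hv : ∀ i : Fin N, N ≤ (i : ℕ) + r → |v i| ≤ B) (k : ℕ) :
    ∀ i : Fin N, N + k ≤ (i : ℕ) + r → |((Dmat N) ^ k).mulVec v i| ≤ 2 ^ k * B := by
  induction k with
  | zero => intro i hi; simpa using hv i (by omega)
  | succ k ih =>
    intro i hi
    rw [pow_succ', ← Matrix.mulVec_mulVec, Dmat_mulVec]
    set w := ((Dmat N) ^ k).mulVec v
    have e1 : shiftExt w (i + 1) = w i := by simp [shiftExt]
    have h1 : |w i| ≤ 2 ^ k * B := ih i (by omega)
    have h2 : |shiftExt w i| ≤ 2 ^ k * B := by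
      unfold shiftExt
      split_ifs with h
      · exact ih _ (by simp only; omega)
      · simp; positivity
    rw [e1, pow_succ]
    have := abs_sub (w i) (shiftExt w i)
    linarith

lemma cos_fin_sub {N : ℕ} (hN : 0 < N) (m n : Fin N) (k : ℤ) :
    Real.cos (2 * Real.pi * (k : ℝ) * (((m - n : Fin N) : ℕ) : ℝ) / N) =
      Real.cos (2 * Real.pi * (k : ℝ) * (((m : ℕ) : ℝ) - ((n : ℕ) : ℝ)) / N) := by
  have hN' : (N : ℝ) ≠ 0 := by positivity
  have hmod := Nat.mod_add_div (N - (n : ℕ) + m) N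
  rw [← Fin.val_sub] at hmod
  generalize (N - (n : ℕ) + m) / N = c at hmod
  have hn := n.2
  have h2 : (((m - n : Fin N) : ℕ) : ℝ) = (m : ℕ) - (n : ℕ) + N * (1 - c) := by
    have : ((m - n : Fin N) : ℕ) + N * c + n = N + m := by omega
    have h3 : ((((m - n : Fin N) : ℕ) : ℝ)) + N * c + (n : ℕ) = N + (m : ℕ) := by
      exact_mod_cast this
    linarith
  rw [h2, ← Real.cos_add_int_mul_two_pi (2 * Real.pi * (k : ℝ) * (((m : ℕ) : ℝ) - ((n : ℕ) : ℝ)) / N)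
    (k * (1 - c))]
  congr 1
  push_cast
  field_simp

/-- for the boundary-augmented circulant TV decoder,
`|∑ₙ (x̂-x)ₙ| ≤ δ/N^r`, and hence `P_L(x̂-x)` agrees with the circular
convolution `K_L ∗ (x̂-x)` up to `δ/N^{r+1}` in the sup norm. -/
theorem sigma_delta_mean_and_convolution_bound
    (N β r M : ℕ) (hN : 0 < N) (hβ : β = 1 ∨ β = 2) (hr : 2 ≤ r) (hβr : β ≤ r)
    (hM : 128 ≤ M)
    (δ : ℝ) (hδ : 0 < δ)
    (x q xhat : Fin N → ℝ)
    (hx : ∀ i, x i ∈ Set.Icc (0 : ℝ) 1)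
    (hsep : minSep N M ((D1mat N ^ β).mulVec x))
    (hxfeas : ∀ i, |(((Dmat N)⁻¹ ^ r).mulVec (x - q)) i| ≤ δ / 2)
    (hxbd : ∀ i : Fin N, N - r ≤ (i : ℕ) →
      |(((Dmat N)⁻¹ ^ r).mulVec (x - q)) i| ≤ (1 / (2 * (N : ℝ))) ^ r * δ)
    (hxhatfeas : ∀ i, |(((Dmat N)⁻¹ ^ r).mulVec (xhat - q)) i| ≤ δ / 2)
    (hxhatbd : ∀ i : Fin N, N - r ≤ (i : ℕ) →
      |(((Dmat N)⁻¹ ^ r).mulVec (xhat - q)) i| ≤ (1 / (2 * (N : ℝ))) ^ r * δ)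
    (hmin : ∀ z : Fin N → ℝ,
      (∀ i, |(((Dmat N)⁻¹ ^ r).mulVec (z - q)) i| ≤ δ / 2) →
      (∀ i : Fin N, N - r ≤ (i : ℕ) →
        |(((Dmat N)⁻¹ ^ r).mulVec (z - q)) i| ≤ (1 / (2 * (N : ℝ))) ^ r * δ) →
      l1 ((D1mat N ^ β).mulVec xhat) ≤ l1 ((D1mat N ^ β).mulVec z)) :
    |∑ n, (xhat - x) n| ≤ δ / (N : ℝ) ^ r ∧
    ∀ L : ℕ, 1 ≤ L → 2 * L ≤ N →
      ∀ m : Fin N,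
        |((Pproj N L).mulVec (xhat - x)) m -
            ∑ n : Fin N, KLvec N L (m - n) * (xhat - x) n| ≤
          δ / (N : ℝ) ^ (r + 1) := by
  have hN' : (0 : ℝ) < N := by exact_mod_cast hN
  have hsum : |∑ n, (xhat - x) n| ≤ δ / (N : ℝ) ^ r := by
    set v := ((Dmat N)⁻¹ ^ r).mulVec (xhat - x) with hvdef
    have hv : v = ((Dmat N)⁻¹ ^ r).mulVec (xhat - q) - ((Dmat N)⁻¹ ^ r).mulVec (x - q) := by
      rw [hvdef, ← Matrix.mulVec_sub]; congr 1; abel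
    set B : ℝ := 2 * ((1 / (2 * (N : ℝ))) ^ r * δ) with hBdef
    have hB : 0 ≤ B := by positivity
    have hvb : ∀ i : Fin N, N ≤ (i : ℕ) + r → |v i| ≤ B := by
      intro i hi
      have h1 := hxbd i (by omega)
      have h2 := hxhatbd i (by omega)
      rw [hv, Pi.sub_apply]
      have := abs_sub (((Dmat N)⁻¹ ^ r).mulVec (xhat - q) i) (((Dmat N)⁻¹ ^ r).mulVec (x - q) i)
      linarith
    obtain ⟨s, rfl⟩ : ∃ s, r = s + 1 := ⟨r - 1, by omega⟩
    have hy : xhat - x = (Dmat N).mulVec (((Dmat N) ^ s).mulVec v) := by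
      have hinv : (Dmat N) ^ (s + 1) * (Dmat N)⁻¹ ^ (s + 1) = 1 := by
        rw [← (Commute.mul_pow _ (s + 1)), Matrix.mul_nonsing_inv _ (Dmat_isUnit N), one_pow]
        change _ * _ = _ * _
        rw [Matrix.mul_nonsing_inv _ (Dmat_isUnit N), Matrix.nonsing_inv_mul _ (Dmat_isUnit N)]
      rw [Matrix.mulVec_mulVec, ← pow_succ', hvdef, Matrix.mulVec_mulVec, hinv, Matrix.one_mulVec]
    rw [hy, sum_Dmat_mulVec hN]
    refine (Dmat_pow_bound v B hB hvb s _ (by simp only; omega)).trans (le_of_eq ?_)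
    rw [hBdef, one_div, inv_pow, mul_pow]
    field_simp
    ring
  refine ⟨hsum, fun L hL1 hL2 m => ?_⟩
  have key : ((Pproj N L).mulVec (xhat - x)) m -
            ∑ n : Fin N, KLvec N L (m - n) * (xhat - x) n
      = (1 / (N : ℝ)) * ∑ n, (xhat - x) n := by
    unfold Matrix.mulVec dotProduct
    rw [← Finset.sum_sub_distrib, Finset.mul_sum]
    refine Finset.sum_congr rfl fun n _ => ?_
    rw [← sub_mul]
    congr 1
    simp only [Pproj, KLvec, Matrix.of_apply]
    rw [← Finset.add_sum_erase (Finset.Icc (-(L : ℤ)) (L : ℤ)) _ (a := 0) (by simp)]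
    simp_rw [cos_fin_sub hN]
    simp
    ring
  rw [key, abs_mul, abs_of_pos (by positivity : (0:ℝ) < 1 / N), pow_succ]
  calc 1 / (N : ℝ) * |∑ n, (xhat - x) n| ≤ 1 / N * (δ / (N : ℝ) ^ r) := by gcongr
    _ = _ := by field_simp
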